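/- Let {x_n}_{n≥0} ⊆ R be a null sequence of nonzero reals such that each ratio q_n := x_{n−1}/x_n is an integer with q_n ≥ 8 for all n ≥ 1. Then the set {0} ∪ {±x_n | n ∈ ℕ} is quasi-convex in R. -/

import Mathlib

open Filter Topology

noncomputable section

abbrev 𝕋 := AddCircle (1 : ℝ)

/-- `T₊ = π([-1/4, 1/4]) ⊆ 𝕋`. -/
def Tplus : Set 𝕋 := {x | ∃ r : ℝ, |r| ≤ 1/4 ∧ (r : 𝕋) = x}

/-- The polar `E^▷`: continuous characters mapping `E` into `T₊`. -/
def polar (G : Type*) [AddCommGroup G] [TopologicalSpace G] (E : Set G) :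
    Set (G →+ 𝕋) := {χ | Continuous χ ∧ ∀ x ∈ E, χ x ∈ Tplus}

/-- The quasi-convex hull `Q_G(E) = E^▷◁`. -/
def qcHull (G : Type*) [AddCommGroup G] [TopologicalSpace G] (E : Set G) : Set G :=
  {x | ∀ χ ∈ polar G E, χ x ∈ Tplus}

/-- The set `S = {0} ∪ {± x_n | n ∈ ℕ}` associated to a sequence. -/
def seqSet {G : Type*} [AddCommGroup G] (x : ℕ → G) : Set G :=
  {0} ∪ {y | ∃ n, y = x n ∨ y = - x n}

/-- `X = {0} ∪ {±(1/b_n mod 1) | n ∈ ℕ} ⊆ 𝕋`. -/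
def Xset (b : ℕ → ℕ) : Set 𝕋 :=
  {0} ∪ {x | ∃ n, x = (((b n : ℝ)⁻¹ : ℝ) : 𝕋) ∨ x = -(((b n : ℝ)⁻¹ : ℝ) : 𝕋)}

/-- The real number `w` lies at distance at most `1/4` from an integer. -/
def NearInt (w : ℝ) : Prop := ∃ k : ℤ, |w - k| ≤ 1 / 4

theorem coe_mem_Tplus_iff (w : ℝ) : ((w : ℝ) : 𝕋) ∈ Tplus ↔ NearInt w := by
  constructor
  · rintro ⟨r, hr, h⟩
    have h0 : ((w - r : ℝ) : 𝕋) = 0 := by rw [AddCircle.coe_sub, h, sub_self]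
    obtain ⟨k, hk⟩ := (AddCircle.coe_eq_zero_iff (1 : ℝ)).1 h0
    refine ⟨k, ?_⟩
    have : w - k = r := by
      simp only [zsmul_eq_mul, mul_one] at hk
      linarith
    rwa [this]
  · rintro ⟨k, hk⟩
    refine ⟨w - k, hk, ?_⟩
    rw [AddCircle.coe_sub, sub_eq_self]
    exact (AddCircle.coe_eq_zero_iff (1 : ℝ)).2 ⟨k, by simp⟩

theorem NearInt.of_abs_le {w : ℝ} (h : |w| ≤ 1 / 4) : NearInt w := ⟨0, by simpa using h⟩

theorem NearInt.add_int {w : ℝ} (h : NearInt w) (a : ℤ) : NearInt (w + a) := by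
  obtain ⟨k, hk⟩ := h
  refine ⟨k + a, ?_⟩
  push_cast
  rwa [add_sub_add_right_eq_sub]

theorem NearInt.sub_int {w : ℝ} (h : NearInt w) (a : ℤ) : NearInt (w - a) := by
  simpa [sub_eq_add_neg] using h.add_int (-a)

theorem NearInt.intCast (a : ℤ) : NearInt a := ⟨a, by norm_num⟩

theorem NearInt.abs_le {w : ℝ} (h : NearInt w) (hw : |w| < 3 / 4) : |w| ≤ 1 / 4 := by
  obtain ⟨k, hk⟩ := h
  have hw' := abs_lt.1 hw
  have hk' := _root_.abs_le.1 hk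
  have h1 : (k : ℝ) < 1 := by linarith
  have h2 : (-1 : ℝ) < k := by linarith
  have h1' : k < 1 := by exact_mod_cast h1
  have h2' : -1 < k := by exact_mod_cast h2
  obtain rfl : k = 0 := by omega
  simpa using hk

/-- If all multiples `m * θ` with `1 ≤ m ≤ M` are within `1/4` of an integer, then `θ` is within
`1/(4M)` of an integer. -/
theorem exists_int_mul_abs_sub_le {θ : ℝ} {M : ℕ} (hM : 1 ≤ M)
    (h : ∀ m : ℕ, 1 ≤ m → m ≤ M → NearInt (m * θ)) :
    ∃ a : ℤ, M * |θ - a| ≤ 1 / 4 := by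
  obtain ⟨a, ha⟩ := h 1 le_rfl hM
  rw [Nat.cast_one, one_mul] at ha
  refine ⟨a, ?_⟩
  induction M, hM using Nat.le_induction with
  | base => simpa using ha
  | succ m hm ih =>
    have ih := ih fun k hk hkm => h k hk (by omega)
    have hm' : (1 : ℝ) ≤ m := by exact_mod_cast hm
    have hnear : NearInt (((m + 1 : ℕ) : ℝ) * (θ - a)) := by
      have := (h (m + 1) (by omega) le_rfl).sub_int ((m + 1 : ℕ) * a)
      convert this using 1
      push_cast
      ring
    have habs : |((m + 1 : ℕ) : ℝ) * (θ - a)| = ((m + 1 : ℕ) : ℝ) * |θ - a| := by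
      rw [abs_mul, Nat.abs_cast]
    rw [← habs]
    refine hnear.abs_le ?_
    rw [habs]
    push_cast
    linarith

/-- If all real multiples `s * θ` with `|s| ≤ 2` are within `1/4` of an integer, then
`|θ| ≤ 1/8`. -/
theorem two_mul_abs_le {θ : ℝ} (h : ∀ s : ℝ, |s| ≤ 2 → NearInt (s * θ)) : 2 * |θ| ≤ 1 / 4 := by
  by_contra! hlt
  have hpos : 0 < |θ| := by linarith
  by_cases h2 : 2 * |θ| < 3 / 4
  · have := (h 2 (by norm_num)).abs_le (by rwa [abs_mul, abs_two])
    rw [abs_mul, abs_two] at this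
    linarith
  · have habs : |1 / (2 * |θ|) * θ| = 1 / 2 := by
      rw [abs_mul, abs_of_pos (by positivity)]
      field_simp
    have hs : |1 / (2 * |θ|)| ≤ 2 := by
      rw [abs_of_pos (by positivity), div_le_iff₀ (by positivity)]
      linarith
    have := (h _ hs).abs_le (by rw [habs]; norm_num)
    rw [habs] at this
    norm_num at this

theorem nearInt_mul_of_mem_qcHull {E : Set ℝ} {z : ℝ} (hz : z ∈ qcHull ℝ E) (r : ℝ)
    (hr : ∀ x ∈ E, NearInt (r * x)) : NearInt (r * z) := by
  let χ : ℝ →+ 𝕋 :=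
    (QuotientAddGroup.mk' (AddSubgroup.zmultiples (1 : ℝ))).comp (AddMonoidHom.mulLeft r)
  have hχ : ∀ x, χ x = ((r * x : ℝ) : 𝕋) := fun _ => rfl
  have hcont : Continuous χ :=
    (AddCircle.continuous_mk' (1 : ℝ)).comp (continuous_const.mul continuous_id)
  rw [← coe_mem_Tplus_iff, ← hχ]
  refine hz χ ⟨hcont, fun x hx => ?_⟩
  rw [hχ, coe_mem_Tplus_iff]
  exact hr x hx

theorem subset_qcHull {G : Type*} [AddCommGroup G] [TopologicalSpace G] (E : Set G) :
    E ⊆ qcHull G E := fun x hx _ hχ => hχ.2 x hx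

/-- Membership in the hull of `seqSet`, tested on characters `x ↦ r * x`. -/
theorem nearInt_mul_of_mem_qcHull_seqSet {x : ℕ → ℝ} {z : ℝ} (hz : z ∈ qcHull ℝ (seqSet x))
    (r : ℝ) (hr : ∀ n, NearInt (r * x n)) : NearInt (r * z) := by
  refine nearInt_mul_of_mem_qcHull hz r ?_
  rintro _ (rfl | ⟨n, rfl | rfl⟩)
  · exact NearInt.of_abs_le (by simp)
  · exact hr n
  · obtain ⟨k, hk⟩ := hr n
    refine ⟨-k, ?_⟩
    rw [← abs_neg]
    convert hk using 2
    push_cast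
    ring

section Ratios

variable {y : ℕ → ℝ} {p : ℕ → ℤ}

theorem exists_int_mul_of_le (hp : ∀ n, 8 ≤ p n) (hy : ∀ n, y n = p n * y (n + 1)) {i j : ℕ}
    (hij : i ≤ j) : ∃ N : ℤ, 1 ≤ N ∧ y i = N * y j := by
  induction j, hij using Nat.le_induction with
  | base => exact ⟨1, le_rfl, by simp⟩
  | succ j _ ih =>
    obtain ⟨N, hN, h⟩ := ih
    refine ⟨N * p j, by nlinarith [hp j], ?_⟩
    rw [h, hy j]
    push_cast
    ring

theorem exists_int_mul_of_lt (hp : ∀ n, 8 ≤ p n) (hy : ∀ n, y n = p n * y (n + 1)) {i j : ℕ}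
    (hij : i < j) : ∃ N : ℤ, 1 ≤ N ∧ y i = p i * (N * y j) := by
  obtain ⟨N, hN, h⟩ := exists_int_mul_of_le hp hy (Nat.succ_le_of_lt hij)
  exact ⟨N, hN, by rw [hy i, h]⟩

theorem exists_int_div (hy0 : ∀ n, y n ≠ 0) (hp : ∀ n, 8 ≤ p n)
    (hy : ∀ n, y n = p n * y (n + 1)) {i j : ℕ} (hij : i ≤ j) : ∃ N : ℤ, y i / y j = N := by
  obtain ⟨N, -, h⟩ := exists_int_mul_of_le hp hy hij
  exact ⟨N, by rw [h, mul_div_cancel_right₀ _ (hy0 j)]⟩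

theorem div_pos_and_mul_div_le (hy0 : ∀ n, y n ≠ 0) (hp : ∀ n, 8 ≤ p n)
    (hy : ∀ n, y n = p n * y (n + 1)) {i j : ℕ} (hij : i < j) :
    0 < y j / y i ∧ p i * (y j / y i) ≤ 1 := by
  obtain ⟨N, hN, h⟩ := exists_int_mul_of_lt hp hy hij
  have hN' : (1 : ℝ) ≤ N := by exact_mod_cast hN
  have hp' : (8 : ℝ) ≤ p i := by exact_mod_cast hp i
  have hj := hy0 j
  have hdiv : y j / y i = 1 / (p i * N) := by
    rw [h]
    field_simp
  rw [hdiv]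
  refine ⟨by positivity, ?_⟩
  rw [mul_one_div, div_le_one (by positivity)]
  nlinarith

/-- The characters `m / y i` with `|m| ≤ p i / 4`; here `m` may be non-integral when `i = 0`. -/
theorem nearInt_div_mul (hy0 : ∀ n, y n ≠ 0) (hp : ∀ n, 8 ≤ p n)
    (hy : ∀ n, y n = p n * y (n + 1)) {i : ℕ} {m : ℝ} (hm : 4 * |m| ≤ p i)
    (hint : i = 0 ∨ ∃ a : ℤ, m = a) (n : ℕ) : NearInt (m / y i * y (n + 1)) := by
  rcases le_or_gt (n + 1) i with hni | hni
  · obtain ⟨a, rfl⟩ := hint.resolve_left (by omega)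
    obtain ⟨N, hN⟩ := exists_int_div hy0 hp hy hni
    have : (a : ℝ) / y i * y (n + 1) = ((a * N : ℤ) : ℝ) := by
      push_cast
      rw [← hN]
      ring
    rw [this]
    exact NearInt.intCast _
  · obtain ⟨hpos, hle⟩ := div_pos_and_mul_div_le hy0 hp hy hni
    refine NearInt.of_abs_le ?_
    rw [show m / y i * y (n + 1) = m * (y (n + 1) / y i) by ring, abs_mul, abs_of_pos hpos]
    nlinarith

/-- The characters `m / y i + l / y j`. -/
theorem nearInt_div_add_div_mul (hy0 : ∀ n, y n ≠ 0) (hp : ∀ n, 8 ≤ p n)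
    (hy : ∀ n, y n = p n * y (n + 1)) {i j : ℕ} {m l : ℤ}
    (hm : 4 * |(m : ℝ)| ≤ p i) (hl : 4 * |m * (y j / y i) + l| ≤ p j) (n : ℕ) :
    NearInt ((m / y i + l / y j) * y (n + 1)) := by
  rcases le_or_gt (n + 1) j with hnj | hnj
  · obtain ⟨N, hN⟩ := exists_int_div hy0 hp hy hnj
    have := (nearInt_div_mul hy0 hp hy hm (Or.inr ⟨m, rfl⟩) n).add_int (l * N)
    convert this using 1
    push_cast
    rw [← hN]
    ring
  · obtain ⟨hpos, hle⟩ := div_pos_and_mul_div_le hy0 hp hy hnj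
    have hj := hy0 j
    refine NearInt.of_abs_le ?_
    have : ((m : ℝ) / y i + l / y j) * y (n + 1)
        = (m * (y j / y i) + l) * (y (n + 1) / y j) := by
      field_simp
    rw [this, abs_mul, abs_of_pos hpos]
    nlinarith

/-- The two characters used to exclude two nonzero digits `1` and `d`: here `P`, `Q` are the
ratios attached to the digits, `ψ` is the quotient of the two scales, and `e` is the remainder at
the second scale. -/
theorem exists_digit_multipliers_one {d P Q : ℤ} (hd : d = 1 ∨ d = -1)
    (hP : 8 ≤ P) (hQ : 8 ≤ Q) {ψ e f : ℝ} (hψ : 0 < ψ) (hψ' : P * ψ ≤ 1)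
    (hf : |f| ≤ 1 / 8) (he : |e| ≤ 1 / 8) (hQe : Q * e = d + f) :
    ∃ m l : ℤ, 4 * |(m : ℝ)| ≤ P ∧ 4 * |m * ψ + l| ≤ Q ∧
      1 / 4 < m * (1 / P + e * ψ) + l * e ∧ m * (1 / P + e * ψ) + l * e < 3 / 4 := by
  obtain ⟨M, hM2, hM, hM'⟩ : ∃ M : ℤ, 2 ≤ M ∧ 4 * M ≤ P ∧ P ≤ 4 * M + 3 :=
    ⟨P / 4, by omega, by omega, by omega⟩
  obtain ⟨K, hK2, hK, hK'⟩ : ∃ K : ℤ, 2 ≤ K ∧ 4 * K ≤ Q ∧ Q ≤ 4 * K + 3 :=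
    ⟨Q / 4, by omega, by omega, by omega⟩
  have hM2r : (2 : ℝ) ≤ M := by exact_mod_cast hM2
  have hMr : (4 : ℝ) * M ≤ P := by exact_mod_cast hM
  have hMr' : (P : ℝ) ≤ 4 * M + 3 := by exact_mod_cast hM'
  have hK2r : (2 : ℝ) ≤ K := by exact_mod_cast hK2
  have hKr : (4 : ℝ) * K ≤ Q := by exact_mod_cast hK
  have hKr' : (Q : ℝ) ≤ 4 * K + 3 := by exact_mod_cast hK'
  have hP0 : (0 : ℝ) < P := by linarith
  rw [abs_le] at hf he
  have hu1 : 2 / 11 ≤ (M : ℝ) * (1 / P) := by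
    rw [mul_one_div, div_le_div_iff₀ (by norm_num) hP0]
    linarith
  have hu2 : (M : ℝ) * (1 / P) ≤ 1 / 4 := by
    rw [mul_one_div, div_le_div_iff₀ hP0 (by norm_num)]
    linarith
  have hs0 : 0 < M * ψ := by positivity
  have hs : M * ψ ≤ 1 / 4 := by nlinarith
  have hm : 4 * |(M : ℝ)| ≤ P := by rwa [abs_of_nonneg (by linarith)]
  rcases hd with rfl | rfl
  · push_cast at hQe
    have he0 : 0 < e := by
      by_contra! h
      nlinarith
    have h1 : M * ψ * e ≤ 1 / 4 * (1 / 8) := by gcongr; exact he.2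
    have h2 : 0 < M * ψ * e := by positivity
    refine ⟨M, K - 1, hm, ?_, ?_, ?_⟩
    · push_cast
      rw [abs_of_nonneg (by linarith)]
      linarith
    · push_cast
      nlinarith
    · push_cast
      nlinarith
  · push_cast at hQe
    have he0 : 0 < -e := by
      by_contra! h
      nlinarith
    have h1 : M * ψ * -e ≤ 1 / 4 * (1 / 8) := by gcongr; linarith
    have h2 : 0 < M * ψ * -e := by positivity
    refine ⟨M, -K, hm, ?_, ?_, ?_⟩
    · push_cast
      rw [abs_of_nonpos (by linarith)]
      linarith
    · push_cast
      nlinarith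
    · push_cast
      nlinarith

theorem exists_digit_multipliers {c d P Q : ℤ} (hc : c = 1 ∨ c = -1) (hd : d = 1 ∨ d = -1)
    (hP : 8 ≤ P) (hQ : 8 ≤ Q) {ψ e f : ℝ} (hψ : 0 < ψ) (hψ' : P * ψ ≤ 1)
    (hf : |f| ≤ 1 / 8) (he : |e| ≤ 1 / 8) (hQe : Q * e = d + f) :
    ∃ m l : ℤ, 4 * |(m : ℝ)| ≤ P ∧ 4 * |m * ψ + l| ≤ Q ∧
      1 / 4 < m * (c / P + e * ψ) + l * e ∧ m * (c / P + e * ψ) + l * e < 3 / 4 := by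
  rcases hc with rfl | rfl
  · simpa using exists_digit_multipliers_one hd hP hQ hψ hψ' hf he hQe
  · obtain ⟨m, l, h1, h2, h3, h4⟩ := exists_digit_multipliers_one (d := -d) (e := -e) (f := -f)
      (by omega) hP hQ hψ hψ' (by rwa [abs_neg]) (by rwa [abs_neg]) (by push_cast; linarith)
    have hval : ((-m : ℤ) : ℝ) * (((-1 : ℤ) : ℝ) / P + e * ψ) + ((-l : ℤ) : ℝ) * e
        = m * (1 / P + -e * ψ) + l * -e := by
      push_cast
      ring
    refine ⟨-m, -l, by simpa using h1, ?_, by rwa [hval], by rwa [hval]⟩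
    rw [← abs_neg]
    convert h2 using 3
    push_cast
    ring

/-- Digit expansion of a point `z` of the hull: the integers nearest to `z / y n`. -/
theorem exists_digits (hy0 : ∀ n, y n ≠ 0) (hp0 : p 0 = 8) (hp : ∀ n, 8 ≤ p n)
    (hy : ∀ n, y n = p n * y (n + 1)) {z : ℝ}
    (hz : ∀ r : ℝ, (∀ n, NearInt (r * y (n + 1))) → NearInt (r * z)) :
    ∃ a : ℕ → ℤ, a 0 = 0 ∧ (∀ n, |z / y n - a n| ≤ 1 / 8) ∧
      ∀ n, a (n + 1) - p n * a n = 0 ∨ a (n + 1) - p n * a n = 1 ∨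
        a (n + 1) - p n * a n = -1 := by
  have key : ∀ n, ∃ a : ℤ, (n = 0 → a = 0) ∧
      |z / y n - a| ≤ 1 / 8 ∧ p n * |z / y n - a| ≤ 3 / 2 := by
    intro n
    rcases Nat.eq_zero_or_pos n with rfl | hn
    · have h2 : 2 * |z / y 0| ≤ 1 / 4 := by
        refine two_mul_abs_le fun s hs => ?_
        have := hz (s / y 0) (nearInt_div_mul hy0 hp hy (by
          have : (8 : ℝ) ≤ p 0 := by exact_mod_cast hp 0
          linarith) (Or.inl rfl))
        convert this using 1
        ring
      refine ⟨0, fun _ => rfl, ?_, ?_⟩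
      · rw [Int.cast_zero, sub_zero]
        linarith
      · rw [Int.cast_zero, sub_zero, hp0]
        push_cast
        linarith
    · obtain ⟨M, hM2, hM, hM'⟩ : ∃ M : ℕ, 2 ≤ M ∧ 4 * (M : ℤ) ≤ p n ∧ p n ≤ 4 * M + 3 := by
        have := hp n
        exact ⟨(p n / 4).toNat, by omega, by omega, by omega⟩
      have hMr : (4 : ℝ) * M ≤ p n := by exact_mod_cast hM
      have hMr' : (p n : ℝ) ≤ 4 * M + 3 := by exact_mod_cast hM'
      have hM2r : (2 : ℝ) ≤ M := by exact_mod_cast hM2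
      obtain ⟨a, ha⟩ := exists_int_mul_abs_sub_le (θ := z / y n) (by omega : 1 ≤ M)
        fun m _ hmM => by
          have hmr : (m : ℝ) ≤ M := by exact_mod_cast hmM
          have := hz (m / y n) (nearInt_div_mul hy0 hp hy
            (by rw [Nat.abs_cast]; linarith) (Or.inr ⟨m, by simp⟩))
          convert this using 1
          ring
      have h0 := abs_nonneg (z / y n - a)
      exact ⟨a, by omega, by nlinarith, by nlinarith⟩
  choose a ha0 ha hap using key
  refine ⟨a, ha0 0 rfl, ha, fun n => ?_⟩
  have h1 : p n * (z / y n) = z / y (n + 1) := by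
    have := hy0 (n + 1)
    have hpn : (p n : ℝ) ≠ 0 := by
      have := hp n
      exact_mod_cast (by omega : p n ≠ 0)
    rw [hy n]
    field_simp
  have h2 := ha (n + 1)
  have h3 := hap n
  have hpn : (0 : ℝ) ≤ p n := by
    have := hp n
    exact_mod_cast (by omega : 0 ≤ p n)
  rw [← abs_of_nonneg hpn, ← abs_mul, mul_sub, h1] at h3
  rw [abs_le] at h2 h3
  have h4 : ((a (n + 1) - p n * a n : ℤ) : ℝ) < 2 := by
    push_cast
    linarith
  have h5 : (-2 : ℝ) < ((a (n + 1) - p n * a n : ℤ) : ℝ) := by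
    push_cast
    linarith
  have h4' : a (n + 1) - p n * a n < 2 := by exact_mod_cast h4
  have h5' : -2 < a (n + 1) - p n * a n := by exact_mod_cast h5
  omega

theorem mul_eq_of_digits_eq_zero (hy : ∀ n, y n = p n * y (n + 1)) {a : ℕ → ℤ} {i j : ℕ}
    (hij : i ≤ j) (h : ∀ k, i ≤ k → k < j → a (k + 1) - p k * a k = 0) :
    a j * y j = a i * y i := by
  induction j, hij using Nat.le_induction with
  | base => rfl
  | succ j hj ih =>
    rw [← ih fun k hk hkj => h k hk (by omega), hy j,
      sub_eq_zero.1 (h j hj (by omega))]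
    push_cast
    ring

theorem eq_of_forall_mul_eq (hy0 : ∀ n, y n ≠ 0) (hnull : Tendsto y atTop (𝓝 0)) {z C : ℝ}
    {a : ℕ → ℤ} (ha : ∀ n, |z / y n - a n| ≤ 1 / 8) {i : ℕ} (h : ∀ k, i ≤ k → a k * y k = C) :
    z = C := by
  have hlim : Tendsto (fun n => |y n| * (1 / 8)) atTop (𝓝 0) := by
    simpa using hnull.abs.mul_const (1 / 8 : ℝ)
  have hle : |z - C| ≤ 0 := by
    refine ge_of_tendsto hlim ?_
    filter_upwards [eventually_ge_atTop i] with k hk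
    have hk0 := hy0 k
    have : z - C = y k * (z / y k - a k) := by
      rw [← h k hk]
      field_simp
    rw [this, abs_mul]
    gcongr
    exact ha k
  exact sub_eq_zero.1 (abs_nonpos_iff.1 hle)

theorem eq_zero_or_eq_of_nearInt (hy0 : ∀ n, y n ≠ 0) (hp0 : p 0 = 8) (hp : ∀ n, 8 ≤ p n)
    (hy : ∀ n, y n = p n * y (n + 1)) (hnull : Tendsto y atTop (𝓝 0)) {z : ℝ}
    (hz : ∀ r : ℝ, (∀ n, NearInt (r * y (n + 1))) → NearInt (r * z)) :
    z = 0 ∨ ∃ n, z = y (n + 1) ∨ z = -y (n + 1) := by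
  obtain ⟨a, ha0, ha, hdig⟩ := exists_digits hy0 hp0 hp hy hz
  by_cases hi : ∃ i, a (i + 1) - p i * a i ≠ 0
  swap
  · push Not at hi
    refine Or.inl (eq_of_forall_mul_eq (i := 0) hy0 hnull ha fun k hk => ?_)
    rw [mul_eq_of_digits_eq_zero hy hk fun k _ _ => hi k, ha0]
    simp
  classical
  obtain ⟨i, hi, himin⟩ : ∃ i, a (i + 1) - p i * a i ≠ 0 ∧
      ∀ k < i, a (k + 1) - p k * a k = 0 :=
    ⟨Nat.find hi, Nat.find_spec hi, fun k hk => by simpa using Nat.find_min hi hk⟩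
  have hai : a i = 0 := by
    have := mul_eq_of_digits_eq_zero hy (Nat.zero_le i) fun k _ hk => himin k hk
    simpa [ha0, hy0 i] using this
  have hci := (hdig i).resolve_left hi
  rw [hai, mul_zero, sub_zero] at hci
  by_cases hj : ∃ j, i < j ∧ a (j + 1) - p j * a j ≠ 0
  swap
  · push Not at hj
    have hzC := eq_of_forall_mul_eq (i := i + 1) hy0 hnull ha fun k hk =>
      mul_eq_of_digits_eq_zero hy hk fun k hk' _ => hj k (by omega)
    refine Or.inr ⟨i, ?_⟩
    rcases hci with h | h
    · left; simpa [h] using hzC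
    · right; simpa [h] using hzC
  exfalso
  obtain ⟨j, ⟨hij, hj⟩, hjmin⟩ : ∃ j, (i < j ∧ a (j + 1) - p j * a j ≠ 0) ∧
      ∀ k < j, i < k → a (k + 1) - p k * a k = 0 :=
    ⟨Nat.find hj, Nat.find_spec hj, fun k hk hik => by
      have := Nat.find_min hj hk
      tauto⟩
  have haj : a j * y j = a (i + 1) * y (i + 1) :=
    mul_eq_of_digits_eq_zero hy hij fun k hk hkj => hjmin k hkj (by omega)
  obtain ⟨hψ, hψ'⟩ := div_pos_and_mul_div_le hy0 hp hy hij
  have hpi : (p i : ℝ) ≠ 0 := by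
    have := hp i
    exact_mod_cast (by omega : p i ≠ 0)
  have hyi := hy0 (i + 1)
  have hyj := hy0 j
  have hyj' := hy0 (j + 1)
  have hQe : p j * (z / y j - a j) =
      ((a (j + 1) - p j * a j : ℤ) : ℝ) + (z / y (j + 1) - a (j + 1)) := by
    have hpj : (p j : ℝ) ≠ 0 := by
      have := hp j
      exact_mod_cast (by omega : p j ≠ 0)
    push_cast
    rw [hy j]
    field_simp
    ring
  obtain ⟨m, l, hm, hl, hlow, hup⟩ := exists_digit_multipliers hci ((hdig j).resolve_left hj)
    (hp i) (hp j) hψ hψ' (ha (j + 1)) (ha j) hQe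
  have hval : (m : ℝ) * (a (i + 1) / p i + (z / y j - a j) * (y j / y i)) + l * (z / y j - a j)
      = (m / y i + l / y j) * z - (l * a j : ℤ) := by
    have h1 : (z / y j - a j) * (y j / y i) = z / y i - a (i + 1) / p i := by
      have h2 : (z / y j - a j) * (y j / y i) = (z - a j * y j) / y i := by
        field_simp
      rw [h2, haj, sub_div, hy i]
      congr 1
      field_simp
    rw [h1]
    push_cast
    ring
  rw [hval] at hlow hup
  have hnear := (hz _ (nearInt_div_add_div_mul hy0 hp hy hm hl)).sub_int (l * a j)
  have := hnear.abs_le (abs_lt.2 ⟨by linarith, hup⟩)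
  linarith [le_abs_self (((m : ℝ) / y i + l / y j) * z - (l * a j : ℤ))]

end Ratios

/-- a null sequence of nonzero reals with integer consecutive
ratios `q_n = x_{n-1}/x_n ≥ 8` yields a quasi-convex set
`{0} ∪ {± x_n}` in `ℝ`. -/
theorem stmt17 (x : ℕ → ℝ) (hx0 : ∀ n, x n ≠ 0)
    (hnull : Tendsto x atTop (𝓝 0))
    (hratio : ∀ n : ℕ, 1 ≤ n → ∃ q : ℤ, 8 ≤ q ∧ x (n - 1) = (q : ℝ) * x n) :
    qcHull ℝ (seqSet x) = seqSet x := by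
  refine Set.Subset.antisymm (fun z hz => ?_) (subset_qcHull _)
  choose q hq hxq using fun n => hratio (n + 1) (by omega)
  let y : ℕ → ℝ := fun | 0 => 8 * x 0 | n + 1 => x n
  let p : ℕ → ℤ := fun | 0 => 8 | n + 1 => q n
  have hy0 : ∀ n, y n ≠ 0 := by
    rintro (_ | n)
    · exact mul_ne_zero (by norm_num) (hx0 0)
    · exact hx0 n
  have hp : ∀ n, 8 ≤ p n := by
    rintro (_ | n)
    · exact le_rfl
    · exact hq n
  have hy : ∀ n, y n = p n * y (n + 1) := by
    rintro (_ | n)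
    · simp [y, p]
    · simpa using hxq n
  have hynull : Tendsto y atTop (𝓝 0) := (tendsto_add_atTop_iff_nat 1).1 hnull
  exact eq_zero_or_eq_of_nearInt hy0 rfl hp hy hynull
    fun r hr => nearInt_mul_of_mem_qcHull_seqSet hz r hr
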